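/- Let a : (0,∞) → [0,∞) be measurable, K > 0, α ∈ (0,1), m ≥ 0, and let k be a nonnegative measurable kernel on (0,∞)² with k(x,y) ≤ K (1+a(x))^α (1+a(y))^α for all x, y > 0. Then for every r > 0 and every measurable f : (0,∞) → [0,∞), ∫₀^r (1+x^m) f(x) ( ∫_{r−x}^∞ k(x,y) f(y) dy ) dx ≤ K N_α(f) ( N_α(f)/(1+(r/2)^m) + ∫_{r/2}^∞ (1+a(x))^α (1+x^m) f(x) dx ), where N_α(f) = ∫₀^∞ (1+a(x))^α (1+x^m) f(x) dx. -/

import Mathlib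

open MeasureTheory Set Filter
open scoped ENNReal

/-- the estimate for the coupling term `E₂` between a solution and its
truncation to `(0,r)`:
`∫₀^r (1+x^m) f(x) (∫_{r−x}^∞ k(x,y) f(y) dy) dx
  ≤ K N_α(f) ( N_α(f)/(1+(r/2)^m) + ∫_{r/2}^∞ (1+a(x))^α (1+x^m) f(x) dx )`,
where `N_α(f) = ∫₀^∞ (1+a(x))^α (1+x^m) f(x) dx`. -/
theorem stmt19 (a : ℝ → ℝ) (K α m r : ℝ) (k : ℝ → ℝ → ℝ) (f : ℝ → ℝ)
    (ha_meas : Measurable a) (ha_nonneg : ∀ x, 0 ≤ a x)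
    (hK : 0 < K) (hα : α ∈ Set.Ioo (0:ℝ) 1) (hm : 0 ≤ m)
    (hk_meas : Measurable (Function.uncurry k)) (hk_nonneg : ∀ x y, 0 ≤ k x y)
    (hk_bound : ∀ x y : ℝ, 0 < x → 0 < y →
      k x y ≤ K * (1 + a x) ^ α * (1 + a y) ^ α)
    (hr : 0 < r)
    (hf_meas : Measurable f) (hf_nonneg : ∀ x, 0 ≤ f x) :
    ∫⁻ x in Set.Ioo (0:ℝ) r, ENNReal.ofReal ((1 + x ^ m) * f x) *
        ∫⁻ y in Set.Ioi (r - x), ENNReal.ofReal (k x y * f y)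
      ≤ ENNReal.ofReal K *
          (∫⁻ x in Set.Ioi (0:ℝ),
            ENNReal.ofReal ((1 + a x) ^ α * (1 + x ^ m) * f x)) *
          ((∫⁻ x in Set.Ioi (0:ℝ),
              ENNReal.ofReal ((1 + a x) ^ α * (1 + x ^ m) * f x)) /
              ENNReal.ofReal (1 + (r / 2) ^ m) +
            ∫⁻ x in Set.Ioi (r / 2),
              ENNReal.ofReal ((1 + a x) ^ α * (1 + x ^ m) * f x)) := by
  have hA : ∀ x, 0 < (1 + a x) ^ α := fun x =>
    Real.rpow_pos_of_pos (by linarith [ha_nonneg x]) _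
  set g : ℝ → ℝ≥0∞ := fun x => ENNReal.ofReal ((1 + a x) ^ α * (1 + x ^ m) * f x) with hg
  have hg_meas : Measurable g := by
    simp only [hg]
    fun_prop
  set N := ∫⁻ x in Set.Ioi (0:ℝ), g x with hN
  set G := ∫⁻ x in Set.Ioi (r / 2), g x with hG
  set c := ENNReal.ofReal (1 + (r / 2) ^ m) with hc
  have hcpos : 0 < 1 + (r / 2) ^ m := by positivity
  have hGN : G ≤ N := lintegral_mono_set (Set.Ioi_subset_Ioi (by linarith))
  -- inner bound with a lower bound on the size of `y`
  have key : ∀ x s t : ℝ, 0 < x → 0 ≤ s → s ≤ r - x → 0 < t →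
      (∀ y, s < y → t ≤ 1 + y ^ m) →
      ENNReal.ofReal ((1 + x ^ m) * f x) *
        ∫⁻ y in Set.Ioi (r - x), ENNReal.ofReal (k x y * f y)
      ≤ (ENNReal.ofReal K * ((∫⁻ y in Set.Ioi s, g y) / ENNReal.ofReal t)) * g x := by
    intro x s t hx hs hsx ht hty
    have hxm : 0 ≤ x ^ m := Real.rpow_nonneg hx.le _
    have h1 : ∫⁻ y in Set.Ioi (r - x), ENNReal.ofReal (k x y * f y)
        ≤ ENNReal.ofReal (K * (1 + a x) ^ α / t) * ∫⁻ y in Set.Ioi s, g y := by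
      rw [← lintegral_const_mul _ hg_meas]
      refine (lintegral_mono_set (Set.Ioi_subset_Ioi hsx)).trans ?_
      refine setLIntegral_mono (by fun_prop) ?_
      intro y hy
      have hy' : s < y := hy
      have hy0 : 0 < y := hs.trans_lt hy'
      simp only [hg]
      have hAx := hA x
      have hAy := hA y
      rw [← ENNReal.ofReal_mul (by positivity)]
      apply ENNReal.ofReal_le_ofReal
      have h2 := hk_bound x y hx hy0
      have h3 : 1 ≤ (1 + y ^ m) / t := (one_le_div ht).2 (hty y hy')
      have hfy := hf_nonneg y
      calc k x y * f y ≤ (K * (1 + a x) ^ α * (1 + a y) ^ α) * f y := by gcongr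
        _ ≤ (K * (1 + a x) ^ α * (1 + a y) ^ α) * f y * ((1 + y ^ m) / t) :=
            le_mul_of_one_le_right (by positivity) h3
        _ = _ := by ring
    refine (mul_le_mul_right h1 _).trans (le_of_eq ?_)
    have hAx := hA x
    have hfx := hf_nonneg x
    rw [← mul_assoc, ← ENNReal.ofReal_mul (by positivity), div_eq_mul_inv (∫⁻ y in Set.Ioi s, g y),
      ← ENNReal.ofReal_inv_of_pos ht]
    simp only [hg]
    have e : (1 + x ^ m) * f x * (K * (1 + a x) ^ α / t)
        = K * t⁻¹ * ((1 + a x) ^ α * (1 + x ^ m) * f x) := by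
      rw [div_eq_mul_inv]; ring
    rw [e, ENNReal.ofReal_mul (by positivity), ENNReal.ofReal_mul hK.le]
    ring
  have hsub : Set.Ioo (0:ℝ) r ⊆ Set.Ioc 0 (r / 2) ∪ Set.Ioo (r / 2) r := by
    intro x hx
    rcases le_or_gt x (r / 2) with h | h
    · exact Or.inl ⟨hx.1, h⟩
    · exact Or.inr ⟨h, hx.2⟩
  refine (lintegral_mono_set hsub).trans ((lintegral_union_le _ _ _).trans ?_)
  rw [mul_add]
  refine add_le_add ?_ ?_
  · calc _ ≤ ∫⁻ x in Set.Ioc 0 (r / 2), (ENNReal.ofReal K * (G / c)) * g x := by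
          refine setLIntegral_mono (by fun_prop) ?_
          intro x hx
          refine key x (r / 2) _ hx.1 (by linarith) (by linarith [hx.2]) hcpos ?_
          intro y hy
          have := Real.rpow_le_rpow (by positivity) hy.le hm
          linarith
      _ = (ENNReal.ofReal K * (G / c)) * ∫⁻ x in Set.Ioc 0 (r / 2), g x :=
          lintegral_const_mul _ hg_meas
      _ ≤ (ENNReal.ofReal K * (N / c)) * N := by
          gcongr
          exact lintegral_mono_set (fun x hx => hx.1)
      _ = _ := by ring
  · calc _ ≤ ∫⁻ x in Set.Ioo (r / 2) r, (ENNReal.ofReal K * N) * g x := by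
          refine setLIntegral_mono (by fun_prop) ?_
          intro x hx
          have := key x 0 1 (by linarith [hx.1]) le_rfl (by linarith [hx.2]) one_pos (by
            intro y hy
            have := Real.rpow_nonneg hy.le m
            linarith)
          simpa using this
      _ = (ENNReal.ofReal K * N) * ∫⁻ x in Set.Ioo (r / 2) r, g x :=
          lintegral_const_mul _ hg_meas
      _ ≤ (ENNReal.ofReal K * N) * G := by
          gcongr
          exact lintegral_mono_set (fun x hx => hx.1)
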